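/- Let λ, q ∈ ℝ, let u : ℝ³ → ℝ be C² and φ : ℝ³ → ℝ be C¹ on an open set U ⊆ ℝ³, and define the vector field V(y) = (y·∇u(y))∇u(y) − (|∇u(y)|²/2)·y + (λ/2)u(y)²·y + (q/5)φ(y)|u(y)|⁵·y. Then at every point x ∈ U where Δu(x) + λu(x) + qφ(x)|u(x)|³u(x) = 0, the divergence of V satisfies div V(x) = −(1/2)|∇u(x)|² + (3/2)λu(x)² + (3/5)qφ(x)|u(x)|⁵ + (q/5)(x·∇φ(x))|u(x)|⁵. -/

import Mathlib

open Metric Real Set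
open scoped RealInnerProductSpace

noncomputable section

/-- Euclidean 3-space. -/
abbrev E3 := EuclideanSpace ℝ (Fin 3)

/-- The Laplace operator on functions `ℝ³ → ℝ`. -/
def lap (f : E3 → ℝ) (x : E3) : ℝ :=
  ∑ i : Fin 3, fderiv ℝ (fun y => fderiv ℝ f y (EuclideanSpace.single i 1)) x
    (EuclideanSpace.single i 1)

/-- The divergence of a vector field `V : ℝ³ → ℝ³`, i.e. the trace of its derivative. -/
def divg (V : E3 → E3) (x : E3) : ℝ :=
  ∑ i : Fin 3, fderiv ℝ V x (EuclideanSpace.single i 1) i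

lemma hasDerivAt_abs_pow_five (t : ℝ) :
    HasDerivAt (fun s : ℝ => |s| ^ 5) (5 * |t| ^ 3 * t) t := by
  have h := hasDerivAt_abs_rpow t (p := 5) (by norm_num)
  have h3 : (5 : ℝ) - 2 = (3 : ℕ) := by norm_num
  rw [h3] at h
  simpa only [Real.rpow_natCast, Real.rpow_ofNat] using h

lemma HasFDerivAt.divg_eq {V : E3 → E3} {V' : E3 →L[ℝ] E3} {x : E3} (h : HasFDerivAt V V' x) :
    divg V x = ∑ i : Fin 3, V' (EuclideanSpace.single i 1) i := by
  rw [divg, h.fderiv]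

/-- The Hessian of a `C²` function, as the derivative of its gradient. -/
lemma ContDiffAt.hasFDerivAt_gradient {u : E3 → ℝ} {x : E3} (hu : ContDiffAt ℝ 2 u x) :
    ∃ H : E3 →L[ℝ] E3, HasFDerivAt (gradient u) H x ∧
      (∀ v w, ⟪H v, w⟫ = ⟪H w, v⟫) ∧
      lap u x = ∑ i : Fin 3, H (EuclideanSpace.single i 1) i := by
  have hd : DifferentiableAt ℝ (fderiv ℝ u) x :=
    (hu.fderiv_right (m := 1) (by norm_num)).differentiableAt (by norm_num)
  let T : StrongDual ℝ E3 →L[ℝ] E3 :=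
    { toFun := (InnerProductSpace.toDual ℝ E3).symm
      map_add' := map_add _
      map_smul' := fun c v => by simp
      cont := (InnerProductSpace.toDual ℝ E3).symm.continuous }
  have hT (v w : E3) : ⟪(T.comp (fderiv ℝ (fderiv ℝ u) x)) v, w⟫
      = fderiv ℝ (fderiv ℝ u) x v w :=
    InnerProductSpace.toDual_symm_apply (𝕜 := ℝ)
  refine ⟨T.comp (fderiv ℝ (fderiv ℝ u) x), T.hasFDerivAt.comp x hd.hasFDerivAt, ?_, ?_⟩
  · intro v w
    rw [hT, hT]
    exact hu.isSymmSndFDerivAt (by simp) v w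
  · refine Finset.sum_congr rfl fun i _ => ?_
    rw [fderiv_clm_apply hd (differentiableAt_const _)]
    have := hT (EuclideanSpace.single i 1) (EuclideanSpace.single i 1)
    rw [EuclideanSpace.inner_single_right] at this
    simpa using this.symm

/-- Pohozaev-type pointwise divergence identity for the first equation: if
`Δu + λu + qφ|u|³u = 0` at `x`, then the vector field
`V(y) = (y·∇u)∇u − (|∇u|²/2)y + (λ/2)u²y + (q/5)φ|u|⁵y` satisfies
`div V = −½|∇u|² + (3/2)λu² + (3/5)qφ|u|⁵ + (q/5)(x·∇φ)|u|⁵` at `x`. -/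
theorem pohozaev_divergence_u (lam q : ℝ) (U : Set E3) (hU : IsOpen U) (u φ : E3 → ℝ)
    (hu : ContDiffOn ℝ 2 u U) (hφ : ContDiffOn ℝ 1 φ U)
    (x : E3) (hx : x ∈ U)
    (heq : lap u x + lam * u x + q * φ x * |u x| ^ 3 * u x = 0) :
    divg (fun y => ⟪y, gradient u y⟫ • gradient u y - (‖gradient u y‖ ^ 2 / 2) • y
        + (lam / 2 * (u y) ^ 2) • y + (q / 5 * φ y * |u y| ^ 5) • y) x
      = -(1 / 2) * ‖gradient u x‖ ^ 2 + 3 / 2 * lam * (u x) ^ 2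
        + 3 / 5 * q * φ x * |u x| ^ 5 + q / 5 * ⟪x, gradient φ x⟫ * |u x| ^ 5 := by
  have hux : ContDiffAt ℝ 2 u x := hu.contDiffAt (hU.mem_nhds hx)
  have hφx : ContDiffAt ℝ 1 φ x := hφ.contDiffAt (hU.mem_nhds hx)
  obtain ⟨H, hH, hsymm, hlap⟩ := hux.hasFDerivAt_gradient
  have hdu := (hux.differentiableAt (by norm_num)).hasGradientAt.hasFDerivAt
  have hdφ := (hφx.differentiableAt (by norm_num)).hasGradientAt.hasFDerivAt
  have hid := hasFDerivAt_id (𝕜 := ℝ) x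
  have h1 := (hid.inner ℝ hH).smul hH
  have h2 := ((hH.norm_sq.mul_const (1 / 2)).smul hid)
  have h3 := ((hdu.pow 2).const_mul (lam / 2)).smul hid
  have h4 := ((hdφ.const_mul (q / 5)).mul
    ((hasDerivAt_abs_pow_five (u x)).comp_hasFDerivAt x hdu)).smul hid
  have hV := ((h1.sub h2).add h3).add h4
  have hs (i j : Fin 3) : H (EuclideanSpace.single i 1) j = H (EuclideanSpace.single j 1) i := by
    simpa [EuclideanSpace.inner_single_right] using
      hsymm (EuclideanSpace.single i 1) (EuclideanSpace.single j 1)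
  have key := HasFDerivAt.divg_eq hV
  refine Eq.trans ?_ (key.trans ?_)
  · congr 1
    funext y
    simp [div_eq_mul_inv]
  rw [hlap] at heq
  generalize gradient u x = G
  generalize gradient φ x = K
  simp [Fin.sum_univ_three, PiLp.inner_apply, EuclideanSpace.real_norm_sq_eq] at heq ⊢
  have h01 := hs 0 1
  have h02 := hs 0 2
  have h12 := hs 1 2
  rw [h01, h02, h12]
  linear_combination (x 0 * G 0 + x 1 * G 1 + x 2 * G 2) * heq
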